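/- Let l ≥ 0 and 0 = i_0 < i_1 < … < i_l < i_{l+1} = k be fixed integers. Then almost surely T_{[i_0,i_1,…,i_{l+1}]}(n) ~ n/(log n)^{l+2} as n → ∞, for ℙ-almost every realization α of the Hawkins random sieve. -/

import Mathlib

open MeasureTheory Filter Finset Asymptotics
open scoped Classical

/-- `y_m(α) = ∏_{j ∈ α, j < m} (1 - 1/j)` (empty product = 1). -/
noncomputable def hawkinsY (A : Set ℕ) (m : ℕ) : ℝ :=
  ∏ j ∈ Finset.range m, if j ∈ A then 1 - 1 / (j : ℝ) else 1

/-- The σ-algebra generated by the events `{j ∈ α}` for `2 ≤ j < m`. -/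
def sieveSigma {Ω : Type*} (α : Ω → Set ℕ) (m : ℕ) : MeasurableSpace Ω :=
  MeasurableSpace.generateFrom {s | ∃ j : ℕ, 2 ≤ j ∧ j < m ∧ s = {ω | j ∈ α ω}}

/-- Wunderlich's model of the Hawkins random sieve: a probability space `(Ω, μ)` with a
random subset `α` of `{2,3,4,…}` such that `μ(2 ∈ α) = 1` and, for every `m ≥ 2`, the
conditional probability of `{m ∈ α}` given the σ-algebra generated by the events
`{j ∈ α}`, `2 ≤ j < m`, equals `y_m(α)`. -/
structure IsHawkinsSieve {Ω : Type*} [MeasurableSpace Ω] (μ : Measure Ω)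
    (α : Ω → Set ℕ) : Prop where
  isProb : IsProbabilityMeasure μ
  meas : ∀ n : ℕ, MeasurableSet {ω | n ∈ α ω}
  mem_ge_two : ∀ ω, ∀ n ∈ α ω, 2 ≤ n
  two_mem : μ {ω | 2 ∈ α ω} = 1
  condExp_mem : ∀ m : ℕ, 2 ≤ m →
    μ[Set.indicator {ω | m ∈ α ω} (fun _ => (1 : ℝ)) | sieveSigma α m]
      =ᵐ[μ] fun ω => hawkinsY (α ω) m

/-- `M_k = 1 + ∑_{j=1}^{k-2} 1/j` (so `M_2 = 1`). -/
noncomputable def Mharm (k : ℕ) : ℝ := 1 + ∑ j ∈ Finset.Icc 1 (k - 2), 1 / (j : ℝ)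

/-- `m[i_0,…,i_{l+1}] ∈ α`: for every `h ∈ [0, k]`, `m + h ∈ α` iff `h` is one of the
values `i_0, …, i_{l+1}`. -/
def patMem (A : Set ℕ) (l k : ℕ) (i : ℕ → ℕ) (m : ℕ) : Prop :=
  ∀ h : ℕ, h ≤ k → (m + h ∈ A ↔ ∃ j : ℕ, j ≤ l + 1 ∧ i j = h)

/-- `T_{[i_0,…,i_{l+1}]}(n; α) = #{m ≤ n : m[i_0,…,i_{l+1}] ∈ α}`. -/
noncomputable def hawkinsT (A : Set ℕ) (l k : ℕ) (i : ℕ → ℕ) (n : ℕ) : ℕ :=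
  ((Finset.range (n + 1)).filter fun m => patMem A l k i m).card

/-- `s n ~ n / (log n) ^ r`. -/
def AsympDivLogPow (s : ℕ → ℝ) (r : ℕ) : Prop :=
  Tendsto (fun n : ℕ => s n * Real.log n ^ r / n) atTop (nhds 1)

lemma tendsto_log_natCast_atTop : Tendsto (fun n : ℕ => Real.log n) atTop atTop :=
  Real.tendsto_log_atTop.comp tendsto_natCast_atTop_atTop

lemma tendsto_rpow_mul_log_pow_div (r : ℕ) :
    Tendsto (fun n : ℕ => (n : ℝ) ^ (3 / 4 : ℝ) * Real.log n ^ r / n) atTop (nhds 0) := by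
  have h := (isLittleO_log_rpow_rpow_atTop (r : ℝ)
    (show (0 : ℝ) < 1 / 4 by norm_num)).tendsto_div_nhds_zero.comp
      (tendsto_natCast_atTop_atTop (R := ℝ))
  refine h.congr' ?_
  filter_upwards [eventually_gt_atTop 0] with n hn
  have hn' : (0 : ℝ) < n := by exact_mod_cast hn
  have e : (n : ℝ) = (n : ℝ) ^ (3 / 4 : ℝ) * (n : ℝ) ^ (1 / 4 : ℝ) := by
    rw [← Real.rpow_add hn']; norm_num
  have h3 := Real.rpow_pos_of_pos hn' (3 / 4)
  have h4 := Real.rpow_pos_of_pos hn' (1 / 4)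
  simp only [Function.comp, Real.rpow_natCast]
  rw [div_eq_div_iff h4.ne' hn'.ne']
  calc Real.log n ^ r * (n : ℝ)
      = Real.log n ^ r * ((n : ℝ) ^ (3 / 4 : ℝ) * (n : ℝ) ^ (1 / 4 : ℝ)) := by rw [← e]
    _ = _ := by ring

lemma tendsto_log_pow_div (r : ℕ) :
    Tendsto (fun n : ℕ => Real.log n ^ r / n) atTop (nhds 0) :=
  (Real.isLittleO_pow_log_id_atTop (n := r)).tendsto_div_nhds_zero.comp
    (tendsto_natCast_atTop_atTop (R := ℝ))

lemma AsympDivLogPow.of_abs_sub_le {s t : ℕ → ℝ} {r : ℕ} {C : ℝ} (hs : AsympDivLogPow s r)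
    (h : ∀ᶠ n : ℕ in atTop, |t n - s n| ≤ C * (n : ℝ) ^ (3 / 4 : ℝ)) :
    AsympDivLogPow t r := by
  have h1 : Tendsto (fun n : ℕ => (t n - s n) * Real.log n ^ r / n) atTop (nhds 0) := by
    refine squeeze_zero_norm' ?_ (by simpa using (tendsto_rpow_mul_log_pow_div r).const_mul C)
    filter_upwards [h] with n hn
    have hl : 0 ≤ Real.log n := Real.log_natCast_nonneg n
    rw [norm_div, norm_mul, norm_pow, Real.norm_of_nonneg hl, Real.norm_natCast, Real.norm_eq_abs,
      ← mul_div_assoc, ← mul_assoc]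
    gcongr
  have h2 := Tendsto.add hs h1
  rw [add_zero] at h2
  exact h2.congr fun n => by ring

lemma AsympDivLogPow.of_abs_sub_le_const {s t : ℕ → ℝ} {r : ℕ} {C : ℝ} (hs : AsympDivLogPow s r)
    (h : ∀ n : ℕ, |t n - s n| ≤ C) : AsympDivLogPow t r := by
  refine hs.of_abs_sub_le (C := C) ?_
  filter_upwards [eventually_ge_atTop 1] with n hn
  have hn' : (1 : ℝ) ≤ n := by exact_mod_cast hn
  have hC : 0 ≤ C := (abs_nonneg _).trans (h n)
  exact (h n).trans (le_mul_of_one_le_right hC (Real.one_le_rpow hn' (by norm_num)))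

lemma asympDivLogPow_natCast : AsympDivLogPow (fun n => n) 0 := by
  refine tendsto_const_nhds.congr' ?_
  filter_upwards [eventually_gt_atTop 0] with n hn
  have hn' : (n : ℝ) ≠ 0 := by positivity
  simp [hn']

lemma AsympDivLogPow.sub_of_succ {s t : ℕ → ℝ} {r : ℕ} (hs : AsympDivLogPow s r)
    (ht : AsympDivLogPow t (r + 1)) : AsympDivLogPow (fun n => s n - t n) r := by
  have h := Tendsto.sub hs (Tendsto.mul ht tendsto_log_natCast_atTop.inv_tendsto_atTop)
  rw [mul_zero, sub_zero] at h
  refine h.congr' ?_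
  filter_upwards [tendsto_log_natCast_atTop.eventually_gt_atTop 0] with n hn
  simp only [Pi.inv_apply]
  field_simp
  ring

/-- Partial sums weighted by a monotone sequence are controlled by bounded partial sums. -/
lemma abs_sum_mul_le_of_monotone {b d : ℕ → ℝ} {C : ℝ} (hb : Monotone b) (hb0 : 0 ≤ b 0)
    (hd : ∀ n, |∑ j ∈ range n, d j| ≤ C) (n : ℕ) :
    |∑ j ∈ range n, b j * d j| ≤ 2 * C * b n := by
  have hC : 0 ≤ C := (abs_nonneg _).trans (hd 0)
  have key : ∀ n, |(∑ j ∈ range n, b j * d j) - b n * ∑ j ∈ range n, d j| ≤ C * (b n - b 0) := by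
    intro n
    induction n with
    | zero => simp
    | succ n ih =>
      have e : (∑ j ∈ range (n + 1), b j * d j) - b (n + 1) * ∑ j ∈ range (n + 1), d j
          = ((∑ j ∈ range n, b j * d j) - b n * ∑ j ∈ range n, d j)
            - (b (n + 1) - b n) * ∑ j ∈ range (n + 1), d j := by
        rw [sum_range_succ, sum_range_succ]; ring
      rw [e]
      refine (abs_sub _ _).trans ?_
      rw [abs_mul, abs_of_nonneg (sub_nonneg.2 (hb n.le_succ))]
      have := mul_le_mul_of_nonneg_left (hd (n + 1)) (sub_nonneg.2 (hb n.le_succ))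
      linarith
  have h1 := key n
  have h2 : |b n * ∑ j ∈ range n, d j| ≤ b n * C := by
    rw [abs_mul, abs_of_nonneg (hb0.trans (hb n.zero_le))]
    exact mul_le_mul_of_nonneg_left (hd n) (hb0.trans (hb n.zero_le))
  have h3 := abs_sub_abs_le_abs_sub (∑ j ∈ range n, b j * d j) (b n * ∑ j ∈ range n, d j)
  nlinarith [mul_nonneg hC hb0]

/-- Weighting the terms of a sum by a decreasing sequence `y n ~ 1 / log n` divides
the asymptotics by `log n`. -/
lemma AsympDivLogPow.sum_mul {a y : ℕ → ℝ} {r : ℕ} (ha0 : ∀ n, 0 ≤ a n) (ha1 : ∀ n, a n ≤ 1)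
    (hy0 : ∀ n, 0 ≤ y n) (hy1 : ∀ n, y n ≤ 1) (hy : Antitone y)
    (hlog : Tendsto (fun n : ℕ => y n * Real.log n) atTop (nhds 1))
    (ha : AsympDivLogPow (fun n => ∑ p ∈ range n, a p) r) :
    AsympDivLogPow (fun n => ∑ p ∈ range n, a p * y p) (r + 1) := by
  set c : ℕ → ℕ := fun n => ⌈(n : ℝ) / Real.log n ^ (r + 2)⌉₊ with hc
  have hL := tendsto_log_natCast_atTop
  have hcge : ∀ n : ℕ, (n : ℝ) / Real.log n ^ (r + 2) ≤ c n := fun n => Nat.le_ceil _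
  have hcle : ∀ᶠ n : ℕ in atTop, c n ≤ n := by
    filter_upwards [hL.eventually_ge_atTop 1] with n hn
    refine Nat.ceil_le.2 (div_le_self (by positivity) (one_le_pow₀ hn))
  have hclt : ∀ n : ℕ, (c n : ℝ) ≤ (n : ℝ) / Real.log n ^ (r + 2) + 1 := fun n =>
    (Nat.ceil_lt_add_one (by have := Real.log_natCast_nonneg n; positivity)).le
  have hratio : Tendsto (fun n : ℕ => Real.log (c n) / Real.log n) atTop (nhds 1) := by
    have hll : Tendsto (fun n : ℕ => 1 - (r + 2) * (Real.log (Real.log n) / Real.log n)) atTop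
        (nhds 1) := by
      have := (Real.isLittleO_log_id_atTop.tendsto_div_nhds_zero.comp hL).const_mul (r + 2 : ℝ)
      simpa using this.const_sub 1
    refine tendsto_of_tendsto_of_tendsto_of_le_of_le' hll tendsto_const_nhds ?_ ?_
    · filter_upwards [hL.eventually_ge_atTop 1, eventually_gt_atTop 0] with n hn hn0
      have hn0' : (0 : ℝ) < n := by exact_mod_cast hn0
      have hlp : 0 < Real.log n := by linarith
      have h1 : Real.log ((n : ℝ) / Real.log n ^ (r + 2)) ≤ Real.log (c n) :=
        Real.log_le_log (by positivity) (hcge n)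
      rw [Real.log_div (by positivity) (by positivity), Real.log_pow] at h1
      rw [le_div_iff₀ hlp]
      have : (1 - ((r : ℝ) + 2) * (Real.log (Real.log n) / Real.log n)) * Real.log n
          = Real.log n - (r + 2) * Real.log (Real.log n) := by field_simp
      rw [this]; push_cast at h1; linarith
    · filter_upwards [hL.eventually_ge_atTop 1, hcle, eventually_gt_atTop 0] with n hn hcn hn0
      have hn0' : (0 : ℝ) < n := by exact_mod_cast hn0
      have hlp : 0 < Real.log n := by linarith
      rw [div_le_one hlp]
      have : (0 : ℝ) < c n := lt_of_lt_of_le (by positivity) (hcge n)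
      exact Real.log_le_log this (by exact_mod_cast hcn)
  have hlogc : Tendsto (fun n : ℕ => Real.log (c n)) atTop atTop := by
    have := Tendsto.pos_mul_atTop one_pos hratio hL
    refine this.congr' ?_
    filter_upwards [hL.eventually_ge_atTop 1] with n hn
    exact div_mul_cancel₀ _ (by linarith)
  have hctop : Tendsto c atTop atTop := by
    rw [← tendsto_natCast_atTop_iff (R := ℝ)]
    refine tendsto_atTop_mono (fun n => ?_) hlogc
    exact Real.log_le_self (Nat.cast_nonneg _)
  have hyc : Tendsto (fun n : ℕ => y (c n) * Real.log n) atTop (nhds 1) := by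
    have h := (hlog.comp hctop).div hratio one_ne_zero
    rw [div_one] at h
    refine h.congr' ?_
    filter_upwards [hL.eventually_ge_atTop 1, hlogc.eventually_ge_atTop 1] with n hn hn2
    have h1 : Real.log n ≠ 0 := by linarith
    have h2 : Real.log (c n) ≠ 0 := by linarith
    simp only [Function.comp, Pi.div_apply]
    field_simp
  have hlow : Tendsto (fun n : ℕ => (y n * Real.log n) *
      ((∑ p ∈ range n, a p) * Real.log n ^ r / n)) atTop (nhds 1) := by
    simpa using hlog.mul ha
  have hupp : Tendsto (fun n : ℕ => ((Real.log n)⁻¹ + Real.log n ^ (r + 1) / n) +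
      (y (c n) * Real.log n) * ((∑ p ∈ range n, a p) * Real.log n ^ r / n)) atTop (nhds 1) := by
    simpa using (hL.inv_tendsto_atTop.add (tendsto_log_pow_div (r + 1))).add (hyc.mul ha)
  refine tendsto_of_tendsto_of_tendsto_of_le_of_le' hlow hupp ?_ ?_
  · filter_upwards with n
    have hl := Real.log_natCast_nonneg n
    have : y n * ∑ p ∈ range n, a p ≤ ∑ p ∈ range n, a p * y p := by
      rw [mul_sum]
      refine sum_le_sum fun p hp => ?_
      rw [mul_comm]
      exact mul_le_mul_of_nonneg_left (hy (mem_range.1 hp).le) (ha0 p)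
    calc _ = (y n * ∑ p ∈ range n, a p) * Real.log n ^ (r + 1) / n := by ring
      _ ≤ _ := by gcongr
  · filter_upwards [hL.eventually_ge_atTop 1, eventually_gt_atTop 0, hcle] with n hn hn0 hcn
    have hn0' : (0 : ℝ) < n := by exact_mod_cast hn0
    have hlp : 0 < Real.log n := by linarith
    have h1 : ∑ p ∈ range n, a p * y p ≤ c n + y (c n) * ∑ p ∈ range n, a p := by
      have : ∀ p ∈ range n, a p * y p ≤ (if p < c n then 1 else 0) + y (c n) * a p := by
        intro p _
        split_ifs with hp
        · have := mul_le_one₀ (ha1 p) (hy0 p) (hy1 p)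
          have := mul_nonneg (hy0 (c n)) (ha0 p)
          linarith
        · rw [zero_add, mul_comm]
          exact mul_le_mul_of_nonneg_right (hy (not_lt.1 hp)) (ha0 p)
      refine (sum_le_sum this).trans ?_
      rw [sum_add_distrib, ← mul_sum, sum_boole]
      gcongr
      refine (card_le_card (t := range (c n)) fun p hp => ?_).trans (card_range _).le
      simpa using (mem_filter.1 hp).2
    calc _ ≤ ((n : ℝ) / Real.log n ^ (r + 2) + 1 + y (c n) * ∑ p ∈ range n, a p)
          * Real.log n ^ (r + 1) / n := by
          gcongr
          exact h1.trans (by gcongr; exact hclt n)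
      _ = _ := by field_simp; ring

lemma summable_one_add_harmonic_div_sq :
    Summable fun n : ℕ => (1 + (harmonic n : ℝ)) / ((n : ℝ) + 1) ^ 2 := by
  have hs := ((summable_nat_add_iff 1).2 (Real.summable_one_div_nat_rpow.2
    (show (1 : ℝ) < 3 / 2 by norm_num))).mul_left 4
  refine Summable.of_nonneg_of_le (fun n => ?_) (fun n => ?_) hs
  · have : (0 : ℝ) ≤ harmonic n := by
      have : (0 : ℚ) ≤ harmonic n := sum_nonneg fun i _ => by positivity
      exact_mod_cast this
    positivity
  · have hn : (0 : ℝ) < n + 1 := by positivity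
    have h1 := harmonic_le_one_add_log n
    have h2 : Real.log n ≤ Real.log (n + 1) := by
      rcases n.eq_zero_or_pos with rfl | h0
      · simp
      · exact Real.log_le_log (by exact_mod_cast h0) (by linarith)
    have h3 := Real.log_le_rpow_div hn.le (show (0 : ℝ) < 1 / 2 by norm_num)
    have h4 : (1 : ℝ) ≤ ((n : ℝ) + 1) ^ (1 / 2 : ℝ) :=
      Real.one_le_rpow (by linarith [Nat.cast_nonneg (α := ℝ) n]) (by norm_num)
    have e : ((n : ℝ) + 1) ^ 2 = ((n : ℝ) + 1) ^ (3 / 2 : ℝ) * ((n : ℝ) + 1) ^ (1 / 2 : ℝ) := by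
      rw [← Real.rpow_add hn, ← Real.rpow_natCast]; norm_num
    have h5 : 1 + (harmonic n : ℝ) ≤ 4 * ((n : ℝ) + 1) ^ (1 / 2 : ℝ) := by linarith
    have h6 := Real.rpow_pos_of_pos hn (3 / 2)
    push_cast
    rw [div_le_iff₀ (by positivity), e]
    calc _ ≤ 4 * ((n : ℝ) + 1) ^ (1 / 2 : ℝ) := h5
      _ = _ := by field_simp

/-- The indicator of membership in `A`, as a real number. -/
noncomputable def memInd (A : Set ℕ) (m : ℕ) : ℝ := if m ∈ A then 1 else 0

lemma memInd_nonneg (A : Set ℕ) (m : ℕ) : 0 ≤ memInd A m := by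
  unfold memInd; split_ifs <;> norm_num

lemma memInd_le_one (A : Set ℕ) (m : ℕ) : memInd A m ≤ 1 := by
  unfold memInd; split_ifs <;> norm_num

lemma memInd_sq (A : Set ℕ) (m : ℕ) : memInd A m ^ 2 = memInd A m := by
  unfold memInd; split_ifs <;> norm_num

section SetFacts

variable {A : Set ℕ}

lemma hawkinsY_succ (A : Set ℕ) (m : ℕ) :
    hawkinsY A (m + 1) = hawkinsY A m * (1 - memInd A m / m) := by
  unfold hawkinsY memInd
  rw [prod_range_succ]
  split_ifs <;> simp

lemma hawkinsY_two (hA : ∀ n ∈ A, 2 ≤ n) : hawkinsY A 2 = 1 := by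
  refine prod_eq_one fun j hj => if_neg fun h => ?_
  have := hA j h
  have := mem_range.1 hj
  omega

lemma memInd_div_le (hA : ∀ n ∈ A, 2 ≤ n) (m : ℕ) : memInd A m / m ≤ 1 / 2 := by
  unfold memInd
  split_ifs with h
  · have : (2 : ℝ) ≤ m := by exact_mod_cast hA m h
    gcongr
  · norm_num

lemma hawkinsY_pos (hA : ∀ n ∈ A, 2 ≤ n) (m : ℕ) : 0 < hawkinsY A m := by
  induction m with
  | zero => simp [hawkinsY]
  | succ m ih =>
    rw [hawkinsY_succ]
    have := memInd_div_le hA m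
    exact mul_pos ih (by linarith)

lemma hawkinsY_antitone (hA : ∀ n ∈ A, 2 ≤ n) : Antitone (hawkinsY A) := by
  refine antitone_nat_of_succ_le fun m => ?_
  rw [hawkinsY_succ]
  have : 0 ≤ memInd A m / m := div_nonneg (memInd_nonneg A m) (Nat.cast_nonneg m)
  exact mul_le_of_le_one_right (hawkinsY_pos hA m).le (by linarith)

lemma hawkinsY_le_one (hA : ∀ n ∈ A, 2 ≤ n) (m : ℕ) : hawkinsY A m ≤ 1 := by
  simpa [hawkinsY] using hawkinsY_antitone hA m.zero_le

lemma inv_hawkinsY_succ (A : Set ℕ) (n : ℕ) :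
    (hawkinsY A (n + 3))⁻¹ = (hawkinsY A (n + 2))⁻¹ * (1 + memInd A (n + 2) / (n + 1)) := by
  rw [hawkinsY_succ, mul_inv]
  congr 1
  have h1 : (n : ℝ) + 1 ≠ 0 := by positivity
  have h2 : (n : ℝ) + 2 ≠ 0 := by positivity
  unfold memInd
  split_ifs
  · have h3 : (1 : ℝ) - 1 / ((n + 2 : ℕ) : ℝ) = (n + 1) / (n + 2) := by
      push_cast; field_simp; ring
    rw [h3, inv_div]
    field_simp; ring
  · simp

lemma inv_hawkinsY_le (hA : ∀ n ∈ A, 2 ≤ n) (n : ℕ) : (hawkinsY A (n + 2))⁻¹ ≤ n + 1 := by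
  induction n with
  | zero => simp [hawkinsY_two hA]
  | succ n ih =>
    rw [inv_hawkinsY_succ]
    have h1 : (0 : ℝ) < n + 1 := by positivity
    have h2 : memInd A (n + 2) / ((n : ℝ) + 1) ≤ 1 / (n + 1) := by
      have := memInd_le_one A (n + 2); gcongr
    calc _ ≤ ((n : ℝ) + 1) * (1 + 1 / (n + 1)) := by
          refine mul_le_mul ih (by linarith) ?_ h1.le
          have := div_nonneg (memInd_nonneg A (n + 2)) h1.le
          linarith
      _ = _ := by
        rw [mul_add, mul_one_div_cancel h1.ne']
        push_cast; ring

lemma inv_hawkinsY_eq (hA : ∀ n ∈ A, 2 ≤ n) (n : ℕ) :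
    (hawkinsY A (n + 2))⁻¹ = 1 + (harmonic n : ℝ) +
      ∑ j ∈ range n, (hawkinsY A (j + 2))⁻¹ / (j + 1) *
        (memInd A (j + 2) - hawkinsY A (j + 2)) := by
  induction n with
  | zero => simp [hawkinsY_two hA]
  | succ n ih =>
    rw [inv_hawkinsY_succ, sum_range_succ, harmonic_succ]
    have h1 : (n : ℝ) + 1 ≠ 0 := by positivity
    have h2 := (hawkinsY_pos hA (n + 2)).ne'
    have h3 : (hawkinsY A (n + 2))⁻¹ * (1 + memInd A (n + 2) / (n + 1)) =
        (hawkinsY A (n + 2))⁻¹ + ((n : ℝ) + 1)⁻¹ +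
          (hawkinsY A (n + 2))⁻¹ / (n + 1) * (memInd A (n + 2) - hawkinsY A (n + 2)) := by
      field_simp; ring
    rw [h3, ih]; push_cast; ring

lemma abs_memInd_sub_hawkinsY_le (hA : ∀ n ∈ A, 2 ≤ n) (m : ℕ) :
    |memInd A m - hawkinsY A m| ≤ 1 := by
  rw [abs_le]
  have := memInd_nonneg A m
  have := memInd_le_one A m
  have := (hawkinsY_pos hA m).le
  have := hawkinsY_le_one hA m
  constructor <;> linarith

end SetFacts

lemma measurable_memInd {Ω : Type*} {α : Ω → Set ℕ} (hA : ∀ ω, ∀ n ∈ α ω, 2 ≤ n)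
    {j m : ℕ} (hj : j < m) :
    Measurable[sieveSigma α m] fun ω => memInd (α ω) j := by
  have hs : MeasurableSet[sieveSigma α m] {ω | j ∈ α ω} := by
    by_cases h2 : 2 ≤ j
    · exact MeasurableSpace.measurableSet_generateFrom ⟨j, h2, hj, rfl⟩
    · have : {ω | j ∈ α ω} = ∅ := Set.eq_empty_of_forall_notMem fun ω h => h2 (hA ω j h)
      rw [this]; exact @MeasurableSet.empty _ (sieveSigma α m)
  exact Measurable.ite hs measurable_const measurable_const

lemma measurable_hawkinsY {Ω : Type*} {α : Ω → Set ℕ}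
    (hA : ∀ ω, ∀ n ∈ α ω, 2 ≤ n) (m : ℕ) :
    Measurable[sieveSigma α m] fun ω => hawkinsY (α ω) m := by
  have : ∀ n ≤ m, Measurable[sieveSigma α m] fun ω => hawkinsY (α ω) n := by
    intro n hn
    induction n with
    | zero => simp only [hawkinsY, range_zero, prod_empty]; exact measurable_const
    | succ n ih =>
      simp only [hawkinsY_succ]
      exact (ih (by omega)).mul (((measurable_memInd hA (by omega)).div_const _).const_sub 1)
  exact this m le_rfl

section Probability

variable {Ω : Type*} [mΩ : MeasurableSpace Ω] {μ : Measure Ω} {α : Ω → Set ℕ}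

/-- The filtration generated by the sieve; at time `n` everything below `n + 2` is known. -/
def sieveFiltration (hα : ∀ n : ℕ, MeasurableSet {ω | n ∈ α ω}) : Filtration ℕ mΩ where
  seq n := sieveSigma α (n + 2)
  mono' := fun a b hab => MeasurableSpace.generateFrom_mono
    fun _ ⟨j, h2, hj, hs⟩ => ⟨j, h2, by omega, hs⟩
  le' := fun n => MeasurableSpace.generateFrom_le fun _ ⟨j, _, _, hs⟩ => hs ▸ hα j

namespace IsHawkinsSieve

lemma condExp_mul_sub (h : IsHawkinsSieve μ α) {n : ℕ} {V : Ω → ℝ}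
    (hV : StronglyMeasurable[sieveFiltration h.meas n] V) {C : ℝ} (hC : ∀ ω, |V ω| ≤ C) :
    μ[fun ω => V ω * (memInd (α ω) (n + 2) - hawkinsY (α ω) (n + 2)) |
      sieveFiltration h.meas n] =ᵐ[μ] 0 := by
  have := h.isProb
  set X : Ω → ℝ := fun ω => memInd (α ω) (n + 2) with hX
  set Y : Ω → ℝ := fun ω => hawkinsY (α ω) (n + 2) with hY
  have hle := (sieveFiltration h.meas).le n
  have hXm : Measurable X := (measurable_memInd h.mem_ge_two (n + 2).lt_succ_self).mono
    ((sieveFiltration h.meas).le (n + 1)) le_rfl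
  have hYm : Measurable[sieveFiltration h.meas n] Y := measurable_hawkinsY h.mem_ge_two (n + 2)
  have hXi : Integrable X μ := Integrable.of_bound hXm.aestronglyMeasurable 1
    (ae_of_all _ fun ω => by
      rw [Real.norm_of_nonneg (memInd_nonneg _ _)]; exact memInd_le_one _ _)
  have hYi : Integrable Y μ := Integrable.of_bound (hYm.mono hle le_rfl).aestronglyMeasurable 1
    (ae_of_all _ fun ω => by
      rw [Real.norm_of_nonneg (hawkinsY_pos (h.mem_ge_two ω) _).le]
      exact hawkinsY_le_one (h.mem_ge_two ω) _)
  have hXc : μ[X | sieveFiltration h.meas n] =ᵐ[μ] Y := by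
    have e : Set.indicator {ω | n + 2 ∈ α ω} (fun _ => (1 : ℝ)) = X := by
      ext ω; simp [hX, memInd, Set.indicator_apply]
    have := h.condExp_mem (n + 2) (by omega)
    rwa [e] at this
  have h1 := condExp_stronglyMeasurable_mul_of_bound hle hV (hXi.sub hYi) C (ae_of_all _ hC)
  have h2 := condExp_sub hXi hYi (sieveFiltration h.meas n)
  rw [condExp_of_stronglyMeasurable hle hYm.stronglyMeasurable hYi] at h2
  refine EventuallyEq.trans h1 ?_
  filter_upwards [h2, hXc] with ω h3 h4
  simp [h3, h4]

lemma integral_mul_sub (h : IsHawkinsSieve μ α) {n : ℕ} {V : Ω → ℝ}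
    (hV : StronglyMeasurable[sieveFiltration h.meas n] V) {C : ℝ} (hC : ∀ ω, |V ω| ≤ C) :
    ∫ ω, V ω * (memInd (α ω) (n + 2) - hawkinsY (α ω) (n + 2)) ∂μ = 0 := by
  have := h.isProb
  rw [← integral_condExp ((sieveFiltration h.meas).le n),
    integral_congr_ae (h.condExp_mul_sub hV hC)]
  simp

lemma stronglyMeasurable_sum_mul_sub (h : IsHawkinsSieve μ α) {V : ℕ → Ω → ℝ}
    (hV : ∀ n, StronglyMeasurable[sieveFiltration h.meas n] (V n)) (n : ℕ) :
    StronglyMeasurable[sieveFiltration h.meas n] fun ω =>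
      ∑ j ∈ range n, V j ω * (memInd (α ω) (j + 2) - hawkinsY (α ω) (j + 2)) := by
  refine Measurable.stronglyMeasurable (Finset.measurable_fun_sum _ fun j hj => ?_)
  have hj := mem_range.1 hj
  refine Measurable.mul ?_ (Measurable.sub ?_ ?_)
  · exact (hV j).measurable.mono ((sieveFiltration h.meas).mono hj.le) le_rfl
  · exact measurable_memInd h.mem_ge_two (by omega)
  · exact (measurable_hawkinsY h.mem_ge_two (j + 2)).mono
      ((sieveFiltration h.meas).mono hj.le) le_rfl

lemma abs_sum_mul_sub_le (h : IsHawkinsSieve μ α) {V : ℕ → Ω → ℝ} {C : ℕ → ℝ}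
    (hC : ∀ n ω, |V n ω| ≤ C n) (n : ℕ) (ω : Ω) :
    |∑ j ∈ range n, V j ω * (memInd (α ω) (j + 2) - hawkinsY (α ω) (j + 2))|
      ≤ ∑ j ∈ range n, C j := by
  refine (abs_sum_le_sum_abs _ _).trans (sum_le_sum fun j _ => ?_)
  rw [abs_mul]
  exact (mul_le_of_le_one_right (abs_nonneg _)
    (abs_memInd_sub_hawkinsY_le (h.mem_ge_two ω) _)).trans (hC j ω)

lemma integral_sum_mul_sub_sq_le (h : IsHawkinsSieve μ α) {V : ℕ → Ω → ℝ}
    (hV : ∀ n, StronglyMeasurable[sieveFiltration h.meas n] (V n)) {C c : ℕ → ℝ}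
    (hC : ∀ n ω, |V n ω| ≤ C n) (hc : ∀ n, ∫ ω, V n ω ^ 2 * hawkinsY (α ω) (n + 2) ∂μ ≤ c n)
    (n : ℕ) :
    ∫ ω, (∑ j ∈ range n, V j ω * (memInd (α ω) (j + 2) - hawkinsY (α ω) (j + 2))) ^ 2 ∂μ
      ≤ ∑ j ∈ range n, c j := by
  have := h.isProb
  have hle := (sieveFiltration h.meas).le
  induction n with
  | zero => simp
  | succ n ih =>
    set N : Ω → ℝ := fun ω =>
      ∑ j ∈ range n, V j ω * (memInd (α ω) (j + 2) - hawkinsY (α ω) (j + 2)) with hN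
    set X : Ω → ℝ := fun ω => memInd (α ω) (n + 2) with hX
    set Y : Ω → ℝ := fun ω => hawkinsY (α ω) (n + 2) with hY
    set B : ℝ := ∑ j ∈ range n, C j with hB
    have hNm : StronglyMeasurable[sieveFiltration h.meas n] N :=
      h.stronglyMeasurable_sum_mul_sub hV n
    have hNb : ∀ ω, |N ω| ≤ B := h.abs_sum_mul_sub_le hC n
    have hXm : Measurable X := (measurable_memInd h.mem_ge_two (n + 2).lt_succ_self).mono
      (hle (n + 1)) le_rfl
    have hYm : Measurable[sieveFiltration h.meas n] Y := measurable_hawkinsY h.mem_ge_two (n + 2)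
    have hY0 : ∀ ω, 0 ≤ Y ω := fun ω => (hawkinsY_pos (h.mem_ge_two ω) _).le
    have hY1 : ∀ ω, Y ω ≤ 1 := fun ω => hawkinsY_le_one (h.mem_ge_two ω) _
    have hXY : ∀ ω, |X ω - Y ω| ≤ 1 := fun ω => abs_memInd_sub_hawkinsY_le (h.mem_ge_two ω) _
    set W : Ω → ℝ := fun ω => 2 * N ω * V n ω + V n ω ^ 2 * (1 - 2 * Y ω) with hW
    have hWm : StronglyMeasurable[sieveFiltration h.meas n] W :=
      Measurable.stronglyMeasurable <| ((hNm.measurable.const_mul 2).mul (hV n).measurable).add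
        (((hV n).measurable.pow_const 2).mul ((hYm.const_mul 2).const_sub 1))
    have hsq : ∀ ω, V n ω ^ 2 ≤ C n ^ 2 := fun ω => sq_le_sq.2 ((hC n ω).trans (le_abs_self _))
    have hWb : ∀ ω, |W ω| ≤ 2 * B * C n + C n ^ 2 := by
      intro ω
      refine (abs_add_le _ _).trans (add_le_add ?_ ?_)
      · rw [abs_mul, abs_mul, abs_two]
        have := hNb ω
        have := hC n ω
        have := (abs_nonneg (N ω)).trans (hNb ω)
        gcongr
      · rw [abs_mul, abs_of_nonneg (sq_nonneg _)]
        refine (mul_le_of_le_one_right (sq_nonneg _) ?_).trans (hsq ω)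
        rw [abs_le]
        constructor <;> linarith [hY0 ω, hY1 ω]
    have i1 : Integrable (fun ω => N ω ^ 2) μ :=
      Integrable.of_bound ((hNm.mono (hle n)).pow 2).aestronglyMeasurable (B ^ 2)
        (ae_of_all _ fun ω => by
          rw [Real.norm_of_nonneg (sq_nonneg _)]
          exact sq_le_sq.2 ((hNb ω).trans (le_abs_self _)))
    have i2 : Integrable (fun ω => W ω * (X ω - Y ω)) μ :=
      Integrable.of_bound ((hWm.mono (hle n)).measurable.mul
        (hXm.sub (hYm.mono (hle n) le_rfl))).aestronglyMeasurable (2 * B * C n + C n ^ 2)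
        (ae_of_all _ fun ω => by
          rw [Real.norm_eq_abs, abs_mul]
          exact (mul_le_of_le_one_right (abs_nonneg _) (hXY ω)).trans (hWb ω))
    have i3 : Integrable (fun ω => V n ω ^ 2 * Y ω) μ :=
      Integrable.of_bound ((((hV n).mono (hle n)).measurable.pow_const 2).mul
        (hYm.mono (hle n) le_rfl)).aestronglyMeasurable (C n ^ 2)
        (ae_of_all _ fun ω => by
          rw [Real.norm_of_nonneg (mul_nonneg (sq_nonneg _) (hY0 ω))]
          exact (mul_le_of_le_one_right (sq_nonneg _) (hY1 ω)).trans (hsq ω))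
    have hNX : Integrable (fun ω => (∑ j ∈ range (n + 1),
        V j ω * (memInd (α ω) (j + 2) - hawkinsY (α ω) (j + 2))) ^ 2) μ :=
      Integrable.of_bound (((h.stronglyMeasurable_sum_mul_sub hV (n + 1)).mono
        (hle (n + 1))).pow 2).aestronglyMeasurable ((∑ j ∈ range (n + 1), C j) ^ 2)
        (ae_of_all _ fun ω => by
          rw [Real.norm_of_nonneg (sq_nonneg _)]
          exact sq_le_sq.2 ((h.abs_sum_mul_sub_le hC (n + 1) ω).trans (le_abs_self _)))
    calc _ ≤ ∫ ω, N ω ^ 2 + W ω * (X ω - Y ω) + V n ω ^ 2 * Y ω ∂μ := by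
          refine integral_mono hNX ((i1.add i2).add i3) fun ω => ?_
          have e : (∑ j ∈ range (n + 1),
              V j ω * (memInd (α ω) (j + 2) - hawkinsY (α ω) (j + 2)))
              = N ω + V n ω * (X ω - Y ω) := sum_range_succ _ _
          have hx : X ω ^ 2 = X ω := memInd_sq _ _
          have : (N ω + V n ω * (X ω - Y ω)) ^ 2 = N ω ^ 2 + W ω * (X ω - Y ω) + V n ω ^ 2 * Y ω
              - (V n ω * Y ω) ^ 2 := by
            simp only [hW]
            linear_combination V n ω ^ 2 * hx
          simp only [e, this]
          linarith [sq_nonneg (V n ω * Y ω)]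
      _ = ∫ ω, N ω ^ 2 ∂μ + ∫ ω, W ω * (X ω - Y ω) ∂μ + ∫ ω, V n ω ^ 2 * Y ω ∂μ := by
          have i12 : Integrable (fun ω => N ω ^ 2 + W ω * (X ω - Y ω)) μ := i1.add i2
          rw [integral_add i12 i3, integral_add i1 i2]
      _ ≤ ∑ j ∈ range (n + 1), c j := by
          rw [h.integral_mul_sub hWm hWb, add_zero, sum_range_succ]
          exact add_le_add ih (hc n)

/-- Almost sure convergence of predictably weighted centered sums with summable variances. -/
lemma ae_exists_tendsto_sum_mul_sub (h : IsHawkinsSieve μ α) {V : ℕ → Ω → ℝ}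
    (hV : ∀ n, StronglyMeasurable[sieveFiltration h.meas n] (V n)) {C c : ℕ → ℝ}
    (hC : ∀ n ω, |V n ω| ≤ C n) (hc : ∀ n, ∫ ω, V n ω ^ 2 * hawkinsY (α ω) (n + 2) ∂μ ≤ c n)
    (hsum : Summable c) :
    ∀ᵐ ω ∂μ, ∃ L, Tendsto (fun n => ∑ j ∈ range n,
      V j ω * (memInd (α ω) (j + 2) - hawkinsY (α ω) (j + 2))) atTop (nhds L) := by
  have := h.isProb
  have hle := (sieveFiltration h.meas).le
  set N : ℕ → Ω → ℝ := fun n ω =>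
    ∑ j ∈ range n, V j ω * (memInd (α ω) (j + 2) - hawkinsY (α ω) (j + 2)) with hN
  have hNm : ∀ n, StronglyMeasurable[sieveFiltration h.meas n] (N n) :=
    h.stronglyMeasurable_sum_mul_sub hV
  have hNb : ∀ n ω, |N n ω| ≤ ∑ j ∈ range n, C j := h.abs_sum_mul_sub_le hC
  have hNi : ∀ n, Integrable (N n) μ := fun n =>
    Integrable.of_bound ((hNm n).mono (hle n)).aestronglyMeasurable _ (ae_of_all _ (hNb n))
  have hNi2 : ∀ n, Integrable (fun ω => N n ω ^ 2) μ := fun n =>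
    Integrable.of_bound (((hNm n).mono (hle n)).pow 2).aestronglyMeasurable
      ((∑ j ∈ range n, C j) ^ 2) (ae_of_all _ fun ω => by
        rw [Real.norm_of_nonneg (sq_nonneg _)]
        exact sq_le_sq.2 ((hNb n ω).trans (le_abs_self _)))
  have hmart : Martingale N (sieveFiltration h.meas) μ := by
    refine martingale_of_condExp_sub_eq_zero_nat hNm hNi fun n => ?_
    have e : N (n + 1) - N n =
        fun ω => V n ω * (memInd (α ω) (n + 2) - hawkinsY (α ω) (n + 2)) := by
      ext ω; simp [hN, sum_range_succ]
    rw [e]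
    exact h.condExp_mul_sub (hV n) (hC n)
  have hc0 : ∀ n, 0 ≤ c n := fun n => (integral_nonneg fun ω =>
    mul_nonneg (sq_nonneg _) (hawkinsY_pos (h.mem_ge_two ω) _).le).trans (hc n)
  have hbdd : ∀ n, eLpNorm (N n) 1 μ ≤ ((1 + ∑' j, c j).toNNReal : ENNReal) := by
    intro n
    rw [eLpNorm_one_eq_lintegral_enorm, ← ofReal_integral_norm_eq_lintegral_enorm (hNi n)]
    refine ENNReal.ofReal_le_ofReal ?_
    calc ∫ ω, ‖N n ω‖ ∂μ ≤ ∫ ω, 1 + N n ω ^ 2 ∂μ := by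
          refine integral_mono (hNi n).norm ((integrable_const 1).add (hNi2 n)) fun ω => ?_
          simp only [Real.norm_eq_abs]
          nlinarith [sq_abs (N n ω), sq_nonneg (|N n ω| - 1)]
      _ = 1 + ∫ ω, N n ω ^ 2 ∂μ := by
          rw [integral_add (integrable_const 1) (hNi2 n)]; simp
      _ ≤ _ := by
          gcongr
          exact (h.integral_sum_mul_sub_sq_le hV hC hc n).trans
            (hsum.sum_le_tsum _ fun j _ => hc0 j)
  filter_upwards [hmart.submartingale.ae_tendsto_limitProcess hbdd] with ω hω
  exact ⟨_, hω⟩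

lemma stronglyMeasurable_inv_hawkinsY_div (h : IsHawkinsSieve μ α) (n : ℕ) :
    StronglyMeasurable[sieveFiltration h.meas n] fun ω =>
      (hawkinsY (α ω) (n + 2))⁻¹ / ((n : ℝ) + 1) :=
  ((measurable_hawkinsY h.mem_ge_two (n + 2)).inv.div_const _).stronglyMeasurable

lemma abs_inv_hawkinsY_div_le (h : IsHawkinsSieve μ α) (n : ℕ) (ω : Ω) :
    |(hawkinsY (α ω) (n + 2))⁻¹ / ((n : ℝ) + 1)| ≤ 1 := by
  have := (inv_pos.2 (hawkinsY_pos (h.mem_ge_two ω) (n + 2))).le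
  rw [abs_of_nonneg (by positivity)]
  exact div_le_one_of_le₀ (inv_hawkinsY_le (h.mem_ge_two ω) n) (by positivity)

lemma integral_inv_hawkinsY (h : IsHawkinsSieve μ α) (n : ℕ) :
    ∫ ω, (hawkinsY (α ω) (n + 2))⁻¹ ∂μ = 1 + (harmonic n : ℝ) := by
  have := h.isProb
  rw [integral_congr_ae (ae_of_all _ fun ω => inv_hawkinsY_eq (h.mem_ge_two ω) n)]
  have hV := h.stronglyMeasurable_inv_hawkinsY_div
  have hC := h.abs_inv_hawkinsY_div_le
  have hi : ∀ j, Integrable (fun ω => (hawkinsY (α ω) (j + 2))⁻¹ / ((j : ℝ) + 1) *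
      (memInd (α ω) (j + 2) - hawkinsY (α ω) (j + 2))) μ := by
    intro j
    refine Integrable.of_bound (C := 1) ?_ (ae_of_all _ fun ω => ?_)
    · refine (((hV j).measurable.mono ((sieveFiltration h.meas).le j) le_rfl).mul
        (Measurable.sub ?_ ?_)).aestronglyMeasurable
      · exact (measurable_memInd h.mem_ge_two (j + 2).lt_succ_self).mono
          ((sieveFiltration h.meas).le (j + 1)) le_rfl
      · exact (measurable_hawkinsY h.mem_ge_two (j + 2)).mono
          ((sieveFiltration h.meas).le j) le_rfl
    · rw [Real.norm_eq_abs, abs_mul]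
      exact mul_le_one₀ (hC j ω) (abs_nonneg _) (abs_memInd_sub_hawkinsY_le (h.mem_ge_two ω) _)
  rw [integral_add (integrable_const _) (integrable_finsetSum _ fun j _ => hi j),
    integral_finsetSum _ fun j _ => hi j,
    sum_eq_zero fun j _ => h.integral_mul_sub (hV j) (hC j)]
  simp

/-- Almost surely `y_n ~ 1 / log n`. -/
lemma ae_tendsto_hawkinsY_mul_log (h : IsHawkinsSieve μ α) :
    ∀ᵐ ω ∂μ, Tendsto (fun n : ℕ => hawkinsY (α ω) n * Real.log n) atTop (nhds 1) := by
  have hc : ∀ n : ℕ, ∫ ω, ((hawkinsY (α ω) (n + 2))⁻¹ / ((n : ℝ) + 1)) ^ 2 *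
      hawkinsY (α ω) (n + 2) ∂μ ≤ (1 + (harmonic n : ℝ)) / ((n : ℝ) + 1) ^ 2 := by
    intro n
    rw [← h.integral_inv_hawkinsY n, ← integral_div]
    refine le_of_eq (integral_congr_ae (ae_of_all _ fun ω => ?_))
    have := (hawkinsY_pos (h.mem_ge_two ω) (n + 2)).ne'
    simp only
    field_simp
  filter_upwards [h.ae_exists_tendsto_sum_mul_sub h.stronglyMeasurable_inv_hawkinsY_div
    (C := fun _ => 1) h.abs_inv_hawkinsY_div_le hc summable_one_add_harmonic_div_sq] with ω ⟨L, hL⟩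
  have hA := h.mem_ge_two ω
  rw [← tendsto_add_atTop_iff_nat 2]
  have hlog : Tendsto (fun n : ℕ => Real.log ((n + 2 : ℕ) : ℝ)) atTop atTop :=
    tendsto_log_natCast_atTop.comp (tendsto_add_atTop_nat 2)
  have hh : Tendsto (fun n : ℕ => (harmonic n : ℝ) - Real.log ((n + 2 : ℕ) : ℝ)) atTop
      (nhds Real.eulerMascheroniConstant) := by
    have h1 := (tendsto_add_atTop_iff_nat 2).2 Real.tendsto_harmonic_sub_log
    have h2 := tendsto_one_div_add_atTop_nhds_zero_nat (𝕜 := ℝ)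
    have h3 := (tendsto_add_atTop_iff_nat 1).2 h2
    have h4 := (h1.sub h2).sub h3
    rw [sub_zero, sub_zero] at h4
    refine h4.congr fun n => ?_
    rw [harmonic_succ, harmonic_succ]
    push_cast
    ring
  have hinv : Tendsto (fun n : ℕ => (hawkinsY (α ω) (n + 2))⁻¹ / Real.log ((n + 2 : ℕ) : ℝ)) atTop
      (nhds 1) := by
    have h1 := (((hh.const_add 1).add hL).mul hlog.inv_tendsto_atTop).const_add 1
    rw [mul_zero, add_zero] at h1
    refine h1.congr' ?_
    filter_upwards [hlog.eventually_gt_atTop 0] with n hn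
    rw [inv_hawkinsY_eq hA]
    simp only [Pi.inv_apply]
    field_simp
    ring
  have h5 := hinv.inv₀ one_ne_zero
  rw [inv_one] at h5
  refine h5.congr fun n => ?_
  rw [inv_div, div_inv_eq_mul, mul_comm]

lemma ae_abs_sum_mul_sub_le_rpow (h : IsHawkinsSieve μ α) {a : ℕ → Ω → ℝ}
    (ha : ∀ p, Measurable[sieveSigma α p] (a p)) (ha1 : ∀ p ω, |a p ω| ≤ 1) :
    ∀ᵐ ω ∂μ, ∃ C : ℝ, ∀ᶠ n : ℕ in atTop,
      |∑ p ∈ range n, a p ω * (memInd (α ω) p - hawkinsY (α ω) p)| ≤ C * (n : ℝ) ^ (3 / 4 : ℝ) := by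
  have := h.isProb
  set b : ℕ → ℝ := fun n => ((n : ℝ) + 1) ^ (3 / 4 : ℝ) with hb
  have hb1 : ∀ n, 1 ≤ b n := fun n =>
    Real.one_le_rpow (by linarith [Nat.cast_nonneg (α := ℝ) n]) (by norm_num)
  have hb0 : ∀ n, 0 < b n := fun n => one_pos.trans_le (hb1 n)
  have hbm : Monotone b := fun m n hmn => by
    have : (m : ℝ) ≤ n := by exact_mod_cast hmn
    simp only [hb]; gcongr
  set V : ℕ → Ω → ℝ := fun n ω => a (n + 2) ω / b n with hV
  have hVm : ∀ n, StronglyMeasurable[sieveFiltration h.meas n] (V n) := fun n =>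
    ((ha (n + 2)).div_const _).stronglyMeasurable
  have hVb : ∀ n ω, |V n ω| ≤ 1 / b n := fun n ω => by
    rw [abs_div, abs_of_pos (hb0 n)]
    have := ha1 (n + 2) ω
    have := hb0 n
    gcongr
  have hVc : ∀ n, ∫ ω, V n ω ^ 2 * hawkinsY (α ω) (n + 2) ∂μ ≤ (1 / b n) ^ 2 := by
    intro n
    have := norm_integral_le_of_norm_le_const (μ := μ) (C := (1 / b n) ^ 2)
      (f := fun ω => V n ω ^ 2 * hawkinsY (α ω) (n + 2)) (ae_of_all _ fun ω => by
        have hy := (hawkinsY_pos (h.mem_ge_two ω) (n + 2)).le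
        rw [Real.norm_of_nonneg (mul_nonneg (sq_nonneg _) hy)]
        refine (mul_le_of_le_one_right (sq_nonneg _)
          (hawkinsY_le_one (h.mem_ge_two ω) _)).trans ?_
        exact sq_le_sq.2 ((hVb n ω).trans (le_abs_self _)))
    simp only [probReal_univ, mul_one] at this
    exact (le_abs_self _).trans this
  have hs : Summable fun n => (1 / b n) ^ 2 := by
    have := (summable_nat_add_iff 1).2 (Real.summable_one_div_nat_rpow.2
      (show (1 : ℝ) < 3 / 2 by norm_num))
    refine this.congr fun n => ?_
    have hn : (0 : ℝ) ≤ n + 1 := by positivity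
    simp only [hb, div_pow, one_pow]
    rw [← Real.rpow_natCast, ← Real.rpow_mul hn]
    norm_num
  filter_upwards [h.ae_exists_tendsto_sum_mul_sub hVm hVb hVc hs] with ω ⟨L, hL⟩
  obtain ⟨C, hC⟩ := (Metric.isBounded_range_of_tendsto _ hL).exists_norm_le
  have hC' : ∀ n, |∑ j ∈ range n, V j ω * (memInd (α ω) (j + 2) - hawkinsY (α ω) (j + 2))| ≤ C :=
    fun n => hC _ ⟨n, rfl⟩
  have hC0 : 0 ≤ C := (abs_nonneg _).trans (hC' 0)
  have hA := h.mem_ge_two ω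
  refine ⟨2 * C + 2, ?_⟩
  filter_upwards [eventually_ge_atTop 2] with n hn
  obtain ⟨m, rfl⟩ := Nat.exists_eq_add_of_le' hn
  have hbn : b m ≤ ((m + 2 : ℕ) : ℝ) ^ (3 / 4 : ℝ) := by
    simp only [hb]; push_cast; gcongr; norm_num
  have hterm : ∀ p, |a p ω * (memInd (α ω) p - hawkinsY (α ω) p)| ≤ 1 := fun p => by
    rw [abs_mul]
    exact mul_le_one₀ (ha1 p ω) (abs_nonneg _) (abs_memInd_sub_hawkinsY_le hA p)
  have hmain := abs_sum_mul_le_of_monotone hbm (hb0 0).le hC' m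
  have e : ∑ j ∈ range m, b j * (V j ω * (memInd (α ω) (j + 2) - hawkinsY (α ω) (j + 2)))
      = ∑ j ∈ range m, a (j + 2) ω * (memInd (α ω) (j + 2) - hawkinsY (α ω) (j + 2)) := by
    refine sum_congr rfl fun j _ => ?_
    have := (hb0 j).ne'
    simp only [hV]; field_simp
  rw [e] at hmain
  rw [sum_range_succ', sum_range_succ']
  have h1 := hb1 m
  calc _ ≤ 2 * C * b m + 1 + 1 :=
        (abs_add_le _ _).trans (add_le_add ((abs_add_le _ _).trans
          (add_le_add hmain (hterm _))) (hterm _))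
    _ ≤ (2 * C + 2) * b m := by linarith
    _ ≤ _ := by gcongr

end IsHawkinsSieve
end Probability

/-- Indicator that the last `t` integers before `p` are in `A` exactly in the positions
prescribed by `S` (positions counted from `p - t`); zero if `p < t`. -/
noncomputable def patInd (A S : Set ℕ) : ℕ → ℕ → ℝ
  | 0, _ => 1
  | _ + 1, 0 => 0
  | t + 1, p + 1 => patInd A S t p * if t ∈ S then memInd A p else 1 - memInd A p

lemma patInd_mem_Icc (A S : Set ℕ) (t p : ℕ) : patInd A S t p ∈ Set.Icc (0 : ℝ) 1 := by
  induction t generalizing p with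
  | zero => simp [patInd]
  | succ t ih =>
    cases p with
    | zero => simp [patInd]
    | succ p =>
      have h0 := memInd_nonneg A p
      have h1 := memInd_le_one A p
      rw [patInd]
      split_ifs
      · exact ⟨mul_nonneg (ih p).1 h0, mul_le_one₀ (ih p).2 h0 h1⟩
      · exact ⟨mul_nonneg (ih p).1 (by linarith),
          mul_le_one₀ (ih p).2 (by linarith) (by linarith)⟩

lemma patInd_of_lt (A S : Set ℕ) {t p : ℕ} (hp : p < t) : patInd A S t p = 0 := by
  induction t generalizing p with
  | zero => omega
  | succ t ih =>
    cases p with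
    | zero => rfl
    | succ p => rw [patInd, ih (by omega), zero_mul]

lemma patInd_add (A S : Set ℕ) (t m : ℕ) :
    patInd A S t (t + m) = if ∀ j < t, (m + j ∈ A ↔ j ∈ S) then 1 else 0 := by
  induction t with
  | zero => simp [patInd]
  | succ t ih =>
    rw [Nat.succ_add, patInd, ih, add_comm t m]
    simp only [Nat.forall_lt_succ_right, memInd]
    by_cases h1 : ∀ j < t, (m + j ∈ A ↔ j ∈ S) <;> by_cases h2 : t ∈ S <;>
      by_cases h3 : m + t ∈ A <;> simp [h1, h2, h3]

lemma measurable_patInd {Ω : Type*} {α : Ω → Set ℕ} (hA : ∀ ω, ∀ n ∈ α ω, 2 ≤ n) (S : Set ℕ)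
    (t p : ℕ) : Measurable[sieveSigma α p] fun ω => patInd (α ω) S t p := by
  have key : ∀ q, p ≤ q → Measurable[sieveSigma α q] fun ω => patInd (α ω) S t p := by
    induction t generalizing p with
    | zero => intro q _; simp only [patInd]; exact measurable_const
    | succ t ih =>
      intro q hq
      cases p with
      | zero => simp only [patInd]; exact measurable_const
      | succ p =>
        simp only [patInd]
        have hm := measurable_memInd hA (show p < q by omega)
        split_ifs
        · exact (ih p q (by omega)).mul hm
        · exact (ih p q (by omega)).mul (hm.const_sub 1)
  exact key p le_rfl

lemma abs_sum_range_add_sub_le {a : ℕ → ℝ} (ha : ∀ n, |a n| ≤ 1) (n d : ℕ) :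
    |∑ p ∈ range (n + d), a p - ∑ p ∈ range n, a p| ≤ d := by
  rw [sum_range_add, add_sub_cancel_left]
  refine (abs_sum_le_sum_abs _ _).trans ((sum_le_sum fun j _ => ha (n + j)).trans ?_)
  simp

lemma asympDivLogPow_sum_patInd {A S : Set ℕ} (hA : ∀ n ∈ A, 2 ≤ n)
    (hlog : Tendsto (fun n : ℕ => hawkinsY A n * Real.log n) atTop (nhds 1))
    (hdev : ∀ t, ∃ C : ℝ, ∀ᶠ n : ℕ in atTop,
      |∑ p ∈ range n, patInd A S t p * (memInd A p - hawkinsY A p)| ≤ C * (n : ℝ) ^ (3 / 4 : ℝ))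
    (t : ℕ) :
    AsympDivLogPow (fun n => ∑ p ∈ range n, patInd A S t p) #{j ∈ range t | j ∈ S} := by
  induction t with
  | zero => simpa [patInd] using asympDivLogPow_natCast
  | succ t ih =>
    have hY := ih.sum_mul (fun n => (patInd_mem_Icc A S t n).1) (fun n => (patInd_mem_Icc A S t n).2)
      (fun n => (hawkinsY_pos hA n).le) (hawkinsY_le_one hA) (hawkinsY_antitone hA) hlog
    obtain ⟨C, hC⟩ := hdev t
    have hX : AsympDivLogPow (fun n => ∑ p ∈ range n, patInd A S t p * memInd A p)
        (#{j ∈ range t | j ∈ S} + 1) := by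
      refine hY.of_abs_sub_le (C := C) (hC.mono fun n hn => ?_)
      rw [← sum_sub_distrib]
      simpa only [mul_sub] using hn
    have hstep : AsympDivLogPow (fun n => ∑ p ∈ range n, patInd A S (t + 1) (p + 1))
        #{j ∈ range (t + 1) | j ∈ S} := by
      simp only [patInd]
      rw [range_add_one, filter_insert]
      split_ifs with hS
      · rw [card_insert_of_notMem (by simp)]
        exact hX
      · simpa only [mul_sub, mul_one, sum_sub_distrib] using ih.sub_of_succ hX
    refine hstep.of_abs_sub_le_const (C := 1) fun n => ?_
    have h1 := abs_sum_range_add_sub_le (a := patInd A S (t + 1)) (fun p => by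
      rw [abs_of_nonneg (patInd_mem_Icc A S (t + 1) p).1]
      exact (patInd_mem_Icc A S (t + 1) p).2) n 1
    rw [sum_range_succ'] at h1
    rw [abs_sub_comm]
    simpa [patInd] using h1

lemma hawkinsT_eq_sum_patInd (A : Set ℕ) (l k : ℕ) (i : ℕ → ℕ) (n : ℕ) :
    (hawkinsT A l k i n : ℝ) = ∑ p ∈ range (n + (k + 2)),
      patInd A {h | ∃ j : ℕ, j ≤ l + 1 ∧ i j = h} (k + 1) p := by
  rw [show n + (k + 2) = (k + 1) + (n + 1) by ring, sum_range_add,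
    sum_eq_zero fun p hp => patInd_of_lt _ _ (mem_range.1 hp), zero_add]
  rw [hawkinsT, card_filter, Nat.cast_sum]
  refine sum_congr rfl fun m _ => ?_
  have e : patMem A l k i m ↔
      ∀ h < k + 1, (m + h ∈ A ↔ h ∈ {h | ∃ j : ℕ, j ≤ l + 1 ∧ i j = h}) := by
    simp only [patMem, Set.mem_ofPred_eq, Nat.lt_succ_iff]
  rw [patInd_add]
  by_cases hm : patMem A l k i m
  · rw [if_pos hm, if_pos (e.1 hm), Nat.cast_one]
  · rw [if_neg hm, if_neg (mt e.2 hm), Nat.cast_zero]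

lemma card_filter_range_pattern {l k : ℕ} {i : ℕ → ℕ} {S : Set ℕ} (hlast : i (l + 1) = k)
    (hmono : ∀ j : ℕ, j ≤ l → i j < i (j + 1)) (hS : S = {h | ∃ j : ℕ, j ≤ l + 1 ∧ i j = h}) :
    #{h ∈ range (k + 1) | h ∈ S} = l + 2 := by
  have hlt : StrictMonoOn i (Set.Iic (l + 1)) := by
    refine strictMonoOn_Iic_of_lt_succ fun m hm => ?_
    exact hmono m (Nat.lt_succ_iff.1 hm)
  have e : {h ∈ range (k + 1) | h ∈ S} = image i (range (l + 2)) := by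
    ext x
    simp only [hS, mem_filter, mem_range, Set.mem_ofPred_eq, mem_image]
    constructor
    · rintro ⟨_, j, hj, rfl⟩
      exact ⟨j, by omega, rfl⟩
    · rintro ⟨j, hj, rfl⟩
      have : i j ≤ i (l + 1) := hlt.monotoneOn (Set.mem_Iic.2 (by omega)) (Set.mem_Iic.2 le_rfl)
        (by omega)
      exact ⟨by omega, j, by omega, rfl⟩
  rw [e, card_image_of_injOn, card_range]
  refine hlt.injOn.mono fun x hx => ?_
  have := mem_range.1 hx
  exact Set.mem_Iic.2 (by omega)

theorem hawkinsT_asymptotic (l k : ℕ) (i : ℕ → ℕ) (h0 : i 0 = 0)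
    (hlast : i (l + 1) = k) (hmono : ∀ j : ℕ, j ≤ l → i j < i (j + 1))
    {Ω : Type*} [MeasurableSpace Ω] (μ : Measure Ω) (α : Ω → Set ℕ)
    (h : IsHawkinsSieve μ α) :
    ∀ᵐ ω ∂μ, Tendsto
      (fun n : ℕ => (hawkinsT (α ω) l k i n : ℝ) / ((n : ℝ) / (Real.log n) ^ (l + 2)))
      atTop (nhds 1) := by
  set S : Set ℕ := {h | ∃ j : ℕ, j ≤ l + 1 ∧ i j = h} with hS
  have habs : ∀ A t p, |patInd A S t p| ≤ 1 := fun A t p => by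
    rw [abs_of_nonneg (patInd_mem_Icc A S t p).1]
    exact (patInd_mem_Icc A S t p).2
  have hdev := ae_all_iff.2 fun t => h.ae_abs_sum_mul_sub_le_rpow
    (a := fun p ω => patInd (α ω) S t p) (measurable_patInd h.mem_ge_two S t)
    (fun p ω => habs (α ω) t p)
  filter_upwards [h.ae_tendsto_hawkinsY_mul_log, hdev] with ω hlog hω
  have hs := asympDivLogPow_sum_patInd (h.mem_ge_two ω) hlog hω (k + 1)
  rw [card_filter_range_pattern hlast hmono hS] at hs
  have hT : AsympDivLogPow (fun n => (hawkinsT (α ω) l k i n : ℝ)) (l + 2) := by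
    refine hs.of_abs_sub_le_const (C := ((k + 2 : ℕ) : ℝ)) fun n => ?_
    rw [hawkinsT_eq_sum_patInd]
    exact abs_sum_range_add_sub_le (habs (α ω) (k + 1)) n (k + 2)
  exact Tendsto.congr (fun n => (div_div_eq_mul_div _ _ _).symm) hT
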